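/- arXiv:2511.18540 — 2 statements merged into one kernel-verified Lean document; each statement's English description precedes it below -/
import Mathlib

section
/- Every finite semidistributive extremal lattice is left modular: if L is a finite lattice that is semidistributive and satisfies ℓ(L) = |JIrr(L)| = |MIrr(L)|, then L has a maximal chain all of whose elements are left modular. -/
universe u

/-- A join-irreducible element of a finite lattice: an element covering exactly one element. -/
def IsJoinIrred {α : Type u} [Lattice α] (j : α) : Prop := ∃! b : α, b ⋖ j

/-- A meet-irreducible element of a finite lattice: an element covered by exactly one element. -/
def IsMeetIrred {α : Type u} [Lattice α] (m : α) : Prop := ∃! b : α, m ⋖ b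

/-- The length of a finite poset: the maximum `n` such that there is a chain
`x_0 < x_1 < ⋯ < x_n`. -/
noncomputable def latLen (β : Type u) [Preorder β] : ℕ :=
  sSup {n : ℕ | ∃ f : Fin (n + 1) → β, StrictMono f}

/-- An element `a` of a lattice is left modular if for all `b < c`,
`(b ⊔ a) ⊓ c = b ⊔ (a ⊓ c)`. -/
def LeftModular {α : Type u} [Lattice α] (a : α) : Prop :=
  ∀ b c : α, b < c → (b ⊔ a) ⊓ c = b ⊔ (a ⊓ c)

/-- A lattice is left modular if it has a maximal chain all of whose elements
are left modular. -/
def IsLeftModularLattice (β : Type u) [Lattice β] : Prop :=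
  ∃ s : Set β, IsMaxChain (· ≤ ·) s ∧ ∀ a ∈ s, LeftModular a

/-- A lattice is semidistributive if `x ⊔ y = x ⊔ z → x ⊔ (y ⊓ z) = x ⊔ y` and
`x ⊓ y = x ⊓ z → x ⊓ (y ⊔ z) = x ⊓ y`. -/
def IsSemidistributive (β : Type u) [Lattice β] : Prop :=
  (∀ x y z : β, x ⊔ y = x ⊔ z → x ⊔ (y ⊓ z) = x ⊔ y) ∧
  (∀ x y z : β, x ⊓ y = x ⊓ z → x ⊓ (y ⊔ z) = x ⊓ y)

section Irreducibles

variable {α : Type u} [Lattice α] [Finite α]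

/-- An element minimal among those below `x` and not below `y` is join-irreducible. -/
theorem exists_isJoinIrred_le_not_le {x y : α} (h : ¬ x ≤ y) :
    ∃ j, IsJoinIrred j ∧ j ≤ x ∧ ¬ j ≤ y ∧ ∀ w < j, w ≤ y := by
  obtain ⟨j, ⟨hjx, hjy⟩, hmin⟩ :=
    (Set.toFinite {z : α | z ≤ x ∧ ¬ z ≤ y}).exists_minimal ⟨x, le_rfl, h⟩
  have hlt : ∀ w < j, w ≤ y := fun w hw => by
    by_contra hwy
    exact hw.not_ge (hmin ⟨hw.le.trans hjx, hwy⟩ hw.le)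
  have hyj : y ⊓ j < j := inf_le_right.lt_of_ne fun he => hjy (inf_eq_right.mp he)
  refine ⟨j, ⟨y ⊓ j, ⟨hyj, fun w h₁ h₂ => h₁.not_ge (le_inf (hlt w h₂) h₂.le)⟩, ?_⟩,
    hjx, hjy, hlt⟩
  intro w hw
  by_contra hne
  exact hw.2 ((le_inf (hlt w hw.1) hw.1.le).lt_of_ne hne) hyj

theorem exists_isMeetIrred_ge_not_ge {x y : α} (h : ¬ x ≤ y) :
    ∃ m, IsMeetIrred m ∧ y ≤ m ∧ ¬ x ≤ m := by
  obtain ⟨m, ⟨b, hb, hu⟩, h₁, h₂, -⟩ :=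
    exists_isJoinIrred_le_not_le (α := αᵒᵈ) (x := OrderDual.toDual y) (y := OrderDual.toDual x) h
  exact ⟨OrderDual.ofDual m, ⟨OrderDual.ofDual b, hb.ofDual, fun w hw => hu _ hw.toDual⟩, h₁, h₂⟩

end Irreducibles

section Length

variable (α : Type u) [Fintype α]

theorem bddAbove_strictMono_lengths [Preorder α] :
    BddAbove {n : ℕ | ∃ f : Fin (n + 1) → α, StrictMono f} := by
  refine ⟨Fintype.card α, ?_⟩
  rintro n ⟨f, hf⟩
  have := Fintype.card_le_of_injective f hf.injective
  rw [Fintype.card_fin] at this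
  omega

theorem exists_strictMono_latLen [Preorder α] [Nonempty α] :
    ∃ f : Fin (latLen α + 1) → α, StrictMono f :=
  Nat.sSup_mem (s := {n : ℕ | ∃ f : Fin (n + 1) → α, StrictMono f})
    ⟨0, fun _ => Classical.arbitrary α, fun i j h => absurd h (by omega)⟩ (bddAbove_strictMono_lengths α)

variable {α}

theorem IsChain.ncard_le_latLen_add_one [PartialOrder α] {s : Set α} (hs : IsChain (· ≤ ·) s) :
    s.ncard ≤ latLen α + 1 := by
  classical
  rcases hc : s.ncard with _ | k
  · omega
  refine Nat.succ_le_succ (le_csSup (bddAbove_strictMono_lengths α) ?_)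
  let _ : LinearOrder s :=
    { (inferInstance : PartialOrder s) with
      le_total := fun a b => hs.total a.2 b.2
      toDecidableLE := Classical.decRel _ }
  have hcard : Fintype.card s = k + 1 := by
    rw [← hc, ← Nat.card_coe_set_eq, Nat.card_eq_fintype_card]
  exact ⟨fun i => (Fintype.orderIsoFinOfCardEq s hcard) i,
    fun i j hij => (Fintype.orderIsoFinOfCardEq s hcard).strictMono hij⟩

/-- A chain of maximum length is a maximal chain. -/
theorem isMaxChain_range_of_latLen [PartialOrder α] {f : Fin (latLen α + 1) → α}
    (hf : StrictMono f) : IsMaxChain (· ≤ ·) (Set.range f) := by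
  refine ⟨hf.monotone.isChain_range, fun t ht hst => ?_⟩
  refine Set.eq_of_subset_of_ncard_le hst (ht.ncard_le_latLen_add_one.trans ?_)
  rw [← Nat.card_coe_set_eq, Nat.card_range_of_injective hf.injective, Nat.card_eq_fintype_card,
    Fintype.card_fin]

end Length

/-- An injective family of `n` members of a set with `n` elements exhausts the set. -/
theorem exists_eq_of_injective_of_ncard {α : Type u} [Finite α] {n : ℕ} {s : Set α}
    (hn : n = s.ncard) {g : Fin n → α} (hg : Function.Injective g) (hs : ∀ i, g i ∈ s)
    {x : α} (hx : x ∈ s) : ∃ i, g i = x := by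
  have : Set.range g = s := by
    refine Set.eq_of_subset_of_ncard_le (Set.range_subset_iff.mpr hs) ?_
    rw [← hn, ← Nat.card_coe_set_eq, Nat.card_range_of_injective hg, Nat.card_eq_fintype_card,
      Fintype.card_fin]
  rwa [← this] at hx

/-- Every finite semidistributive extremal lattice is left modular. -/
theorem semidistributive_extremal_leftModular (α : Type u) [Lattice α] [Fintype α] [Nonempty α]
    (hsd : IsSemidistributive α)
    (hJ : latLen α = {j : α | IsJoinIrred j}.ncard)
    (hM : latLen α = {m : α | IsMeetIrred m}.ncard) :
    IsLeftModularLattice α := by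
  obtain ⟨f, hf⟩ := exists_strictMono_latLen α
  have hstep : ∀ {i l : Fin (latLen α)}, i < l → f i.succ ≤ f l.castSucc := fun h =>
    hf.monotone (Fin.succ_le_castSucc_iff.mpr h)
  choose j hjirr hjle hjnle _ using fun i : Fin (latLen α) =>
    exists_isJoinIrred_le_not_le (hf (Fin.castSucc_lt_succ (i := i))).not_ge
  choose m hmirr hmge hjm using fun i => exists_isMeetIrred_ge_not_ge (hjnle i)
  have hmnge : ∀ i, ¬ f i.succ ≤ m i := fun i h => hjm i ((hjle i).trans h)
  have hjinj : Function.Injective j := fun i l h => by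
    by_contra hne
    rcases lt_or_gt_of_ne hne with hlt | hlt
    · exact hjnle l (h ▸ (hjle i).trans (hstep hlt))
    · exact hjnle i (h ▸ (hjle l).trans (hstep hlt))
  have hminj : Function.Injective m := fun i l h => by
    by_contra hne
    rcases lt_or_gt_of_ne hne with hlt | hlt
    · exact hmnge i (h ▸ (hstep hlt).trans (hmge l))
    · exact hmnge l (h ▸ (hstep hlt).trans (hmge i))
  have hlower : ∀ i, ∀ w < j i, w ≤ f i.castSucc := fun i w hw => by
    by_contra hcon
    obtain ⟨j', hj', hle, hnle, -⟩ := exists_isJoinIrred_le_not_le hcon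
    obtain ⟨l, rfl⟩ := exists_eq_of_injective_of_ncard hJ hjinj hjirr hj'
    rcases lt_trichotomy l i with hlt | rfl | hlt
    · exact hnle ((hjle l).trans (hstep hlt))
    · exact hw.not_ge hle
    · exact hjnle l (hle.trans (hw.le.trans ((hjle i).trans (hstep hlt))))
  have hupper : ∀ i u, m i < u → f i.succ ≤ u := fun i u hu => by
    by_contra hcon
    obtain ⟨m', hm', hge, hnge⟩ := exists_isMeetIrred_ge_not_ge hcon
    obtain ⟨l, rfl⟩ := exists_eq_of_injective_of_ncard hM hminj hmirr hm'
    rcases lt_trichotomy l i with hlt | rfl | hlt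
    · exact hmnge l ((hstep hlt).trans ((hmge i).trans (hu.le.trans hge)))
    · exact hu.not_ge hge
    · exact hnge ((hstep hlt).trans (hmge l))
  have hlabel : ∀ b c : α, ¬ c ≤ b → ∃ i, j i ≤ c ∧ ¬ j i ≤ b ∧ b ≤ m i := fun b c hcb => by
    obtain ⟨j', hj', hjc, hjb, hw⟩ := exists_isJoinIrred_le_not_le hcb
    obtain ⟨i, rfl⟩ := exists_eq_of_injective_of_ncard hJ hjinj hjirr hj'
    refine ⟨i, hjc, hjb, ?_⟩
    have hinf : j i ⊓ b = j i ⊓ m i := le_antisymm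
      (le_inf inf_le_left ((hlower i _ (inf_lt_left.mpr hjb)).trans (hmge i)))
      (le_inf inf_le_left (hw _ (inf_lt_left.mpr (hjm i))))
    by_contra hbm
    have hle : j i ≤ b ⊔ m i := (hjle i).trans (hupper i _ (right_lt_sup.mpr hbm))
    have hsup := hsd.2 _ _ _ hinf
    rw [inf_eq_left.mpr hle] at hsup
    exact hjb (inf_eq_left.mp hsup.symm)
  refine ⟨Set.range f, isMaxChain_range_of_latLen hf, ?_⟩
  rintro _ ⟨k, rfl⟩ b c hbc
  refine le_antisymm ?_ (sup_le (le_inf le_sup_left hbc.le) (inf_le_inf_right c le_sup_right))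
  by_contra hcon
  obtain ⟨i, hic, hib, him⟩ := hlabel _ _ hcon
  rcases lt_or_ge i.castSucc k with hik | hki
  · have hjk : j i ≤ f k := (hjle i).trans (hf.monotone (Fin.castSucc_lt_iff_succ_le.mp hik))
    exact hib ((le_inf hjk (hic.trans inf_le_right)).trans le_sup_right)
  · have hkm : f k ≤ m i := (hf.monotone hki).trans (hmge i)
    exact hjm i (hic.trans (inf_le_left.trans (sup_le (le_sup_left.trans him) hkm)))
end

section
/- Let L be a finite lattice and C a nonempty convex subset of L such that no element of C lies on any maximal chain of L consisting of left modular elements. Then the doubling L[C] is not left modular. -/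
universe u v

/-- The order ideal `I_L(C)` generated by a subset `C`. -/
def lowerIdeal {α : Type u} [Preorder α] (C : Set α) : Set α :=
  {y : α | ∃ x ∈ C, y ≤ x}

/-- The underlying subset of `L × {0,1}` of Day's doubling `L[C]`:
`(I_L(C) × {0}) ∪ (((L \ I_L(C)) ∪ C) × {1})`. -/
def doublingSet {α : Type u} [Preorder α] (C : Set α) : Set (α × Bool) :=
  {p : α × Bool | (p.2 = false ∧ p.1 ∈ lowerIdeal C) ∨
    (p.2 = true ∧ (p.1 ∉ lowerIdeal C ∨ p.1 ∈ C))}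

/-- Day's doubling `L[C]`, as a subposet of the product `L × {0,1}` where `0 < 1`. -/
abbrev Doubling {α : Type u} [Preorder α] (C : Set α) : Type u :=
  {p : α × Bool // p ∈ doublingSet C}

/-- A down-closed property separating `⊥` from `⊤` changes along a cover inside any maximal
chain of a finite lattice. -/
theorem IsMaxChain.exists_covBy_of_antitone {M : Type*} [Lattice M] [Finite M] [BoundedOrder M]
    {s : Set M} (hs : IsMaxChain (· ≤ ·) s) {P : M → Prop}
    (hP : ∀ ⦃x y⦄, x ≤ y → P y → P x) (hbot : P ⊥) (htop : ¬ P ⊤) :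
    ∃ x ∈ s, ∃ y ∈ s, P x ∧ ¬ P y ∧ x ⋖ y := by
  obtain ⟨x, hx⟩ := (Set.toFinite {x | x ∈ s ∧ P x}).exists_maximal ⟨⊥, hs.bot_mem, hbot⟩
  obtain ⟨y, hy⟩ := (Set.toFinite {y | y ∈ s ∧ ¬ P y}).exists_minimal ⟨⊤, hs.top_mem, htop⟩
  obtain ⟨⟨hxs, hPx⟩, hxmax⟩ := hx
  obtain ⟨⟨hys, hPy⟩, hymin⟩ := hy
  have hxy : x ≤ y := (hs.1.total hxs hys).resolve_right fun h => hPy (hP h hPx)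
  have hlt : x < y := lt_of_le_of_ne hxy fun h => hPy (h ▸ hPx)
  refine ⟨x, hxs, y, hys, hPx, hPy, hlt, fun z hxz hzy => ?_⟩
  have hcomp : ∀ w ∈ s, z ≤ w ∨ w ≤ z := fun w hw => by
    by_cases hPw : P w
    · exact .inr <| ((hs.1.total hw hxs).elim id (hxmax ⟨hw, hPw⟩)).trans hxz.le
    · exact .inl <| hzy.le.trans <| (hs.1.total hw hys).elim (hymin ⟨hw, hPw⟩) id
  have hzs : z ∈ s := by
    rw [hs.2 (hs.1.insert fun w hw _ => hcomp w hw) (Set.subset_insert z s)]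
    exact Set.mem_insert z s
  by_cases hPz : P z
  · exact hxz.not_ge (hxmax ⟨hzs, hPz⟩ hxz.le)
  · exact hzy.not_ge (hymin ⟨hzs, hPz⟩ hzy.le)

/-- Surjective lattice homomorphisms preserve left modular elements. -/
theorem LeftModular.map {M : Type v} {α : Type u} [Lattice M] [Lattice α] (f : LatticeHom M α)
    (hf : Function.Surjective f) {a : M} (ha : LeftModular a) : LeftModular (f a) := by
  intro b c hbc
  obtain ⟨b, rfl⟩ := hf b
  obtain ⟨c, rfl⟩ := hf c
  have hlt : b ⊓ c < c := lt_of_le_of_ne inf_le_right fun h => by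
    have := congrArg f h
    rw [map_inf, inf_eq_left.2 hbc.le] at this
    exact hbc.ne this
  have := congrArg f (ha _ _ hlt)
  simpa only [map_sup, map_inf, inf_eq_left.2 hbc.le] using this

/-- Surjective homomorphisms of finite lattices map maximal chains onto maximal chains. -/
theorem IsMaxChain.image_latticeHom {M : Type v} {α : Type u} [Lattice M] [Finite M]
    [BoundedOrder M] [Lattice α] (f : LatticeHom M α) (hf : Function.Surjective f) {s : Set M}
    (hs : IsMaxChain (· ≤ ·) s) : IsMaxChain (· ≤ ·) (f '' s) := by
  have hmono : Monotone f := OrderHomClass.mono f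
  refine ⟨hs.1.image (OrderHomClass.toOrderHom f), fun t ht hst => hst.antisymm fun z hz => ?_⟩
  obtain ⟨z, rfl⟩ := hf z
  by_cases htop : f ⊤ ≤ f z
  · exact ⟨⊤, hs.top_mem, htop.antisymm (hmono le_top)⟩
  obtain ⟨x, hxs, y, hys, hxz, hyz, hxy⟩ := hs.exists_covBy_of_antitone
    (P := fun x => f x ≤ f z) (fun _ _ h h' => (hmono h).trans h') (hmono bot_le) htop
  have hzy : f z ≤ f y := (ht.total hz (hst ⟨y, hys, rfl⟩)).resolve_right hyz
  have hw : f ((z ⊔ x) ⊓ y) = f z := by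
    rw [map_inf, map_sup, sup_eq_left.2 hxz, inf_eq_left.2 hzy]
  rcases hxy.eq_or_eq (le_inf le_sup_right hxy.le) inf_le_right with h | h
  · exact ⟨x, hxs, h ▸ hw⟩
  · exact ⟨y, hys, h ▸ hw⟩

namespace Doubling

variable {α : Type u} [Lattice α] {C : Set α}

theorem subset_lowerIdeal : C ⊆ lowerIdeal C := fun c hc => ⟨c, hc, le_rfl⟩

theorem lowerIdeal_of_le {x y : α} (h : x ≤ y) (hy : y ∈ lowerIdeal C) : x ∈ lowerIdeal C :=
  hy.imp fun _ hc => ⟨hc.1, h.trans hc.2⟩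

theorem fst_mem_of_snd_eq_true (p : Doubling C) (hp : p.1.2 = true) (h : p.1.1 ∈ lowerIdeal C) :
    p.1.1 ∈ C := by
  rcases p.2 with h' | h'
  · simp [hp] at h'
  · exact h'.2.resolve_left fun h'' => h'' h

theorem fst_mem_of_snd_eq_false (p : Doubling C) (hp : p.1.2 = false) :
    p.1.1 ∈ lowerIdeal C := by
  rcases p.2 with h' | h'
  · exact h'.2
  · simp [hp] at h'

theorem exists_fst_eq (z : α) : ∃ p : Doubling C, p.1.1 = z := by
  by_cases hz : z ∈ lowerIdeal C
  · exact ⟨⟨(z, false), .inl ⟨rfl, hz⟩⟩, rfl⟩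
  · exact ⟨⟨(z, true), .inr ⟨rfl, .inl hz⟩⟩, rfl⟩

theorem exists_upper_bound (hconv : C.OrdConnected) (p q : Doubling C) :
    ∃ r : Doubling C, p ≤ r ∧ q ≤ r ∧ r.1.1 = p.1.1 ⊔ q.1.1 := by
  by_cases hj : p.1.1 ⊔ q.1.1 ∉ lowerIdeal C ∨ p.1.1 ⊔ q.1.1 ∈ C
  · exact ⟨⟨(_, true), .inr ⟨rfl, hj⟩⟩, ⟨le_sup_left, Bool.le_true _⟩,
      ⟨le_sup_right, Bool.le_true _⟩, rfl⟩
  · push Not at hj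
    obtain ⟨hjI, hjC⟩ := hj
    have hfalse : ∀ r : Doubling C, r.1.1 ≤ p.1.1 ⊔ q.1.1 → r.1.2 ≤ false := by
      intro r hr
      by_contra hne
      have htrue : r.1.2 = true := Bool.eq_true_of_not_eq_false fun h => hne h.le
      obtain ⟨c, hc, hjc⟩ := hjI
      exact hjC <| hconv.out (r.fst_mem_of_snd_eq_true htrue ⟨c, hc, hr.trans hjc⟩) hc ⟨hr, hjc⟩
    exact ⟨⟨(_, false), .inl ⟨rfl, hjI⟩⟩, ⟨le_sup_left, hfalse p le_sup_left⟩,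
      ⟨le_sup_right, hfalse q le_sup_right⟩, rfl⟩

theorem exists_lower_bound (p q : Doubling C) :
    ∃ r : Doubling C, r ≤ p ∧ r ≤ q ∧ r.1.1 = p.1.1 ⊓ q.1.1 := by
  by_cases hm : p.1.1 ⊓ q.1.1 ∈ lowerIdeal C
  · exact ⟨⟨(_, false), .inl ⟨rfl, hm⟩⟩, ⟨inf_le_left, Bool.false_le _⟩,
      ⟨inf_le_right, Bool.false_le _⟩, rfl⟩
  · have htrue : ∀ r : Doubling C, p.1.1 ⊓ q.1.1 ≤ r.1.1 → true ≤ r.1.2 := by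
      intro r hr
      by_contra hne
      have hfalse : r.1.2 = false := Bool.eq_false_of_not_eq_true fun h => hne h.ge
      exact hm (lowerIdeal_of_le hr (r.fst_mem_of_snd_eq_false hfalse))
    exact ⟨⟨(_, true), .inr ⟨rfl, .inl hm⟩⟩, ⟨inf_le_left, htrue p inf_le_left⟩,
      ⟨inf_le_right, htrue q inf_le_right⟩, rfl⟩

/-- The projection onto `L` of a lattice order-isomorphic to `L[C]`. -/
def proj (hconv : C.OrdConnected) {M : Type v} [Lattice M] (e : M ≃o Doubling C) :
    LatticeHom M α where
  toFun x := (e x).1.1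
  map_sup' x y := by
    apply le_antisymm
    · obtain ⟨r, hx, hy, hr⟩ := exists_upper_bound hconv (e x) (e y)
      rw [← hr]
      have : x ⊔ y ≤ e.symm r := sup_le (e.le_symm_apply.2 hx) (e.le_symm_apply.2 hy)
      exact (e.le_symm_apply.1 this).1
    · exact sup_le (e.monotone le_sup_left).1 (e.monotone le_sup_right).1
  map_inf' x y := by
    apply le_antisymm
    · exact le_inf (e.monotone inf_le_left).1 (e.monotone inf_le_right).1
    · obtain ⟨r, hx, hy, hr⟩ := exists_lower_bound (e x) (e y)
      rw [← hr]
      have : e.symm r ≤ x ⊓ y := le_inf (e.symm_apply_le.2 hx) (e.symm_apply_le.2 hy)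
      exact (e.symm_apply_le.1 this).1

theorem proj_surjective (hconv : C.OrdConnected) {M : Type v} [Lattice M]
    (e : M ≃o Doubling C) : Function.Surjective (proj hconv e) := fun z => by
  obtain ⟨p, rfl⟩ := exists_fst_eq (C := C) z
  exact ⟨e.symm p, congrArg (fun q : Doubling C => q.1.1) (e.apply_symm_apply p)⟩

/-- A cover from the bottom level to an element outside the ideal generated by `C` has an upper
element that is not left modular. -/
theorem not_leftModular_of_covBy {M : Type v} [Lattice M] (e : M ≃o Doubling C) {a b : M}
    (hab : a ⋖ b) (ha : (e a).1.2 = false) (hb : (e b).1.2 = true) (hbC : (e b).1.1 ∉ C) :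
    ¬ LeftModular b := by
  intro hmod
  obtain ⟨c, hc, hac⟩ := (e a).fst_mem_of_snd_eq_false ha
  have hbI : (e b).1.1 ∉ lowerIdeal C := fun h => hbC ((e b).fst_mem_of_snd_eq_true hb h)
  let c₀ : Doubling C := ⟨(c, false), .inl ⟨rfl, subset_lowerIdeal hc⟩⟩
  let c₁ : Doubling C := ⟨(c, true), .inr ⟨rfl, .inr hc⟩⟩
  have hac₀ : a ≤ e.symm c₀ := e.le_symm_apply.2 ⟨hac, ha.le⟩
  have hle : c₀ ≤ c₁ := ⟨le_rfl, Bool.false_le _⟩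
  have hnle : ¬ c₁ ≤ c₀ := fun h => absurd h.2 (by decide : ¬ (true ≤ false))
  have hinf : b ⊓ e.symm c₁ = a := by
    refine (hab.eq_or_eq (le_inf hab.le (hac₀.trans (e.symm.monotone hle)))
      inf_le_left).resolve_right fun h => hbI ⟨c, hc, ?_⟩
    exact (e.le_symm_apply.1 (inf_eq_left.1 h)).1
  have hsup : e.symm c₁ ≤ e.symm c₀ ⊔ b := e.symm_apply_le.2
    ⟨(e.symm_apply_le.1 (le_sup_left : e.symm c₀ ≤ e.symm c₀ ⊔ b)).1,
      hb.ge.trans (e.monotone (le_sup_right : b ≤ e.symm c₀ ⊔ b)).2⟩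
  have := hmod _ _ (e.symm.lt_iff_lt.2 (lt_of_le_not_ge hle hnle))
  rw [hinf, inf_eq_right.2 hsup, sup_eq_left.2 hac₀] at this
  exact hnle (e.symm.injective this).le

end Doubling

/-- If `C` is a nonempty convex subset of a finite lattice `L` containing no element of
any maximal chain of `L` consisting of left modular elements, then the doubling `L[C]`
(realized as any lattice order-isomorphic to it) is not left modular. -/
theorem doubling_not_leftModular (α : Type u) [Lattice α] [Fintype α] [Nonempty α]
    (C : Set α) (hne : C.Nonempty) (hconv : C.OrdConnected)
    (hnochain : ∀ c ∈ C, ∀ s : Set α,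
      IsMaxChain (· ≤ ·) s → (∀ a ∈ s, LeftModular a) → c ∉ s)
    (M : Type v) [Lattice M] (e : M ≃o Doubling C) :
    ¬ IsLeftModularLattice M := by
  rintro ⟨s, hs, hmod⟩
  obtain ⟨c, hc⟩ := hne
  have : Finite M := Finite.of_equiv _ e.symm.toEquiv
  let c₀ : Doubling C := ⟨(c, false), .inl ⟨rfl, Doubling.subset_lowerIdeal hc⟩⟩
  let c₁ : Doubling C := ⟨(c, true), .inr ⟨rfl, .inr hc⟩⟩
  have : Nonempty M := ⟨e.symm c₀⟩
  have : Fintype M := Fintype.ofFinite M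
  let _ : BoundedOrder M := Fintype.toBoundedOrder M
  obtain ⟨a, -, b, hbs, ha, hb, hab⟩ := hs.exists_covBy_of_antitone
    (P := fun x => (e x).1.2 ≤ false) (fun _ _ h h' => (e.monotone h).2.trans h')
    (e.le_symm_apply.1 (bot_le : ⊥ ≤ e.symm c₀)).2
    (fun h => absurd ((e.symm_apply_le.1 (le_top : e.symm c₁ ≤ ⊤)).2.trans h)
      (by decide : ¬ (true ≤ false)))
  have hsurj := Doubling.proj_surjective hconv e
  refine Doubling.not_leftModular_of_covBy e hab (ha.antisymm (Bool.false_le _))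
    (Bool.eq_true_of_not_eq_false fun h => hb h.le) (fun hbC => ?_) (hmod b hbs)
  refine hnochain _ hbC _ (hs.image_latticeHom _ hsurj) ?_ ⟨b, hbs, rfl⟩
  rintro _ ⟨x, hx, rfl⟩
  exact (hmod x hx).map _ hsurj
end
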